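/- Let Γ be a primitive distance-regular graph with diameter D ≥ 3 and fix a base vertex x. Then for every 1 ≤ t ≤ D, the three matrices AA_t*A_2 − A_2A_t*A, A_t*A_2 − A_2A_t*, A_t*A − AA_t* are linearly independent over ℂ. -/

import Mathlib

open Matrix BigOperators

noncomputable section

structure DRG (X : Type) [Fintype X] [DecidableEq X] where
  G : SimpleGraph X
  D : ℕ
  hD : 3 ≤ D
  hconn : G.Connected
  hdiam_le : ∀ y z : X, G.dist y z ≤ D
  hdiam : ∃ y z : X, G.dist y z = D
  p : ℕ → ℕ → ℕ → ℕ
  hp : ∀ h i j : ℕ, h ≤ D → i ≤ D → j ≤ D → ∀ y z : X, G.dist y z = h →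
    Nat.card {w : X // G.dist y w = i ∧ G.dist z w = j} = p h i j

namespace DRG

variable {X : Type} [Fintype X] [DecidableEq X]

/-- The `i`-th distance matrix. -/
def A (Γ : DRG X) (i : ℕ) : Matrix X X ℂ :=
  Matrix.of fun y z => if Γ.G.dist y z = i then (1 : ℂ) else 0

/-- `c_i`, with the conventions `c_0 = 0` and `c_{D+1} = 1`. -/
def cI (Γ : DRG X) (i : ℕ) : ℕ :=
  if i = 0 then 0 else if i ≤ Γ.D then Γ.p i 1 (i - 1) else 1

/-- `a_i`. -/
def aI (Γ : DRG X) (i : ℕ) : ℕ := Γ.p i 1 i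

/-- `b_i`, with the convention `b_D = 0`. -/
def bI (Γ : DRG X) (i : ℕ) : ℕ := if i < Γ.D then Γ.p i 1 (i + 1) else 0

/-- `k_i`. -/
def kI (Γ : DRG X) (i : ℕ) : ℕ := Γ.p 0 i i

/-- The valency `k = b_0`. -/
def kval (Γ : DRG X) : ℕ := Γ.p 0 1 1

/-- `Γ` is primitive: each distance-`i` graph is connected. -/
def Primitive (Γ : DRG X) : Prop :=
  ∀ i : ℕ, 1 ≤ i → i ≤ Γ.D →
    (SimpleGraph.fromRel fun y z => Γ.G.dist y z = i).Connected

/-- The Hermitean inner product `⟨R,S⟩ = tr(Rᵗ S̄)`. -/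
def inn (R S : Matrix X X ℂ) : ℂ := (Rᵀ * S.map (starRingEnd ℂ)).trace

/-- The dual idempotent `E_i*` with respect to the base vertex `x`. -/
def Estar (Γ : DRG X) (x : X) (i : ℕ) : Matrix X X ℂ :=
  Matrix.diagonal fun y => if Γ.G.dist x y = i then (1 : ℂ) else 0

/-- The polynomials `v_i`. -/
def vpoly (Γ : DRG X) : ℕ → Polynomial ℝ
  | 0 => 1
  | 1 => Polynomial.X
  | n + 2 =>
      ((Γ.cI (n + 2) : ℝ))⁻¹ •
        (Polynomial.X * vpoly Γ (n + 1) - (Γ.aI (n + 1) : ℝ) • vpoly Γ (n + 1)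
          - (Γ.bI n : ℝ) • vpoly Γ n)

/-- The polynomials `u_i = v_i / k_i`. -/
def upoly (Γ : DRG X) (i : ℕ) : Polynomial ℝ := ((Γ.kI i : ℝ))⁻¹ • Γ.vpoly i

end DRG

/-- A system of primitive idempotents (with eigenvalues and Krein parameters) for `Γ`. -/
structure IdemSys {X : Type} [Fintype X] [DecidableEq X] (Γ : DRG X) where
  E : Fin (Γ.D + 1) → Matrix X X ℂ
  θ : Fin (Γ.D + 1) → ℝ
  q : Fin (Γ.D + 1) → Fin (Γ.D + 1) → Fin (Γ.D + 1) → ℝ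
  hE0 : E 0 = ((Fintype.card X : ℂ))⁻¹ • Matrix.of fun _ _ => (1 : ℂ)
  hEsum : ∑ i, E i = 1
  hEmul : ∀ i j, E i * E j = if i = j then E i else 0
  hEsymm : ∀ i, (E i)ᵀ = E i
  hEreal : ∀ i, (E i).map (starRingEnd ℂ) = E i
  hEbasis : ∀ i, E i ∈ Submodule.span ℂ (Set.range fun n : Fin (Γ.D + 1) => Γ.A (n : ℕ))
  hEig : ∀ j, Γ.A 1 * E j = (θ j : ℂ) • E j
  hθ0 : θ 0 = (Γ.kval : ℝ)
  hθinj : Function.Injective θ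
  hKrein : ∀ i j, Matrix.hadamard (E i) (E j) =
    ((Fintype.card X : ℂ))⁻¹ • ∑ h, (q h i j : ℂ) • E h

namespace IdemSys

variable {X : Type} [Fintype X] [DecidableEq X] {Γ : DRG X}

/-- `m_j`, the rank of `E_j`. -/
def m (I : IdemSys Γ) (j : Fin (Γ.D + 1)) : ℕ := (I.E j).rank

/-- The dual distance matrix `A_i*` with respect to `x` and `E_i`. -/
def Astar (I : IdemSys Γ) (x : X) (i : Fin (Γ.D + 1)) : Matrix X X ℂ :=
  Matrix.diagonal fun y => (Fintype.card X : ℂ) * I.E i x y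

end IdemSys

/-- `Γ` is Q-polynomial with respect to the ordering `E_{σ 0}, ..., E_{σ D}`. -/
def QPolyOrdering {X : Type} [Fintype X] [DecidableEq X] {Γ : DRG X} (I : IdemSys Γ)
    (σ : Equiv.Perm (Fin (Γ.D + 1))) : Prop :=
  ∀ h i j : Fin (Γ.D + 1),
    (((i : ℕ) + (j : ℕ) < (h : ℕ) ∨ (h : ℕ) + (j : ℕ) < (i : ℕ) ∨
        (h : ℕ) + (i : ℕ) < (j : ℕ)) → I.q (σ h) (σ i) (σ j) = 0) ∧
    (((h : ℕ) = (i : ℕ) + (j : ℕ) ∨ (i : ℕ) = (h : ℕ) + (j : ℕ) ∨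
        (j : ℕ) = (h : ℕ) + (i : ℕ)) → I.q (σ h) (σ i) (σ j) ≠ 0)

/-- The matrix `S^alt`. -/
def salt {n : ℕ} (S : Matrix (Fin (n + 1)) (Fin (n + 1)) ℂ) : Matrix (Fin n) (Fin n) ℂ :=
  Matrix.of fun i j => S i.succ j.succ - S 0 j.succ

/-- The matrix `(S^{-1})^alt`. -/
def altInv {n : ℕ} (T : Matrix (Fin (n + 1)) (Fin (n + 1)) ℂ) : Matrix (Fin n) (Fin n) ℂ :=
  Matrix.of fun i j => T i.succ j.succ

/-- The `4D` matrices `A_2E_i*A − AE_i*A_2, A_3E_i* − E_i*A_3, A_2E_i* − E_i*A_2, AE_i* − E_i*A`. -/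
def vecE {X : Type} [Fintype X] [DecidableEq X] (Γ : DRG X) (x : X)
    (a : Fin 4) (i : Fin Γ.D) : Matrix X X ℂ :=
  ![Γ.A 2 * Γ.Estar x ((i : ℕ) + 1) * Γ.A 1 - Γ.A 1 * Γ.Estar x ((i : ℕ) + 1) * Γ.A 2,
    Γ.A 3 * Γ.Estar x ((i : ℕ) + 1) - Γ.Estar x ((i : ℕ) + 1) * Γ.A 3,
    Γ.A 2 * Γ.Estar x ((i : ℕ) + 1) - Γ.Estar x ((i : ℕ) + 1) * Γ.A 2,
    Γ.A 1 * Γ.Estar x ((i : ℕ) + 1) - Γ.Estar x ((i : ℕ) + 1) * Γ.A 1] a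

/-- The `4D` matrices `A_2A_i*A − AA_i*A_2, A_3A_i* − A_i*A_3, A_2A_i* − A_i*A_2, AA_i* − A_i*A`. -/
def vecA {X : Type} [Fintype X] [DecidableEq X] {Γ : DRG X} (I : IdemSys Γ) (x : X)
    (a : Fin 4) (i : Fin Γ.D) : Matrix X X ℂ :=
  ![Γ.A 2 * I.Astar x i.succ * Γ.A 1 - Γ.A 1 * I.Astar x i.succ * Γ.A 2,
    Γ.A 3 * I.Astar x i.succ - I.Astar x i.succ * Γ.A 3,
    Γ.A 2 * I.Astar x i.succ - I.Astar x i.succ * Γ.A 2,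
    Γ.A 1 * I.Astar x i.succ - I.Astar x i.succ * Γ.A 1] a

namespace DRG

variable {X : Type} [Fintype X] [DecidableEq X] (Γ : DRG X)

theorem A_apply (i : ℕ) (y z : X) :
    Γ.A i y z = if Γ.G.dist y z = i then (1 : ℂ) else 0 := rfl

theorem A_mul_A_apply {h i j : ℕ} (hi : i ≤ Γ.D) (hj : j ≤ Γ.D) {y z : X}
    (hyz : Γ.G.dist y z = h) : (Γ.A i * Γ.A j) y z = (Γ.p h i j : ℂ) := by
  have hh : h ≤ Γ.D := hyz ▸ Γ.hdiam_le y z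
  rw [← Γ.hp h i j hh hi hj y z hyz, Matrix.mul_apply, Nat.card_eq_fintype_card,
    Fintype.card_subtype, Finset.card_filter, Nat.cast_sum]
  refine Finset.sum_congr rfl fun w _ => ?_
  rw [A_apply, A_apply, Γ.G.dist_comm (u := w) (v := z)]
  split_ifs <;> simp_all

/-- A vertex at distance `n + 1` has a neighbour at distance `n`. -/
theorem exists_dist_pred {n : ℕ} {y z : X} (h : Γ.G.dist y z = n + 1) :
    ∃ w, Γ.G.dist y w = 1 ∧ Γ.G.dist w z = n := by
  obtain ⟨q, hq⟩ := Γ.hconn.exists_walk_length_eq_dist y z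
  cases q with
  | nil => simp at h
  | @cons _ w _ hadj q =>
    refine ⟨w, SimpleGraph.dist_eq_one_iff_adj.2 hadj, ?_⟩
    have h1 := SimpleGraph.dist_le q
    have h2 := Γ.hconn.dist_triangle (u := y) (v := w) (w := z)
    rw [SimpleGraph.dist_eq_one_iff_adj.2 hadj] at h2
    simp only [SimpleGraph.Walk.length_cons] at hq
    omega

theorem exists_dist_eq (x : X) {n : ℕ} (hn : n ≤ Γ.D) : ∃ z, Γ.G.dist x z = n := by
  have hD : ∃ z, Γ.G.dist z x = Γ.D := by
    obtain ⟨y, z, hyz⟩ := Γ.hdiam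
    have h1 := Γ.hp 0 Γ.D Γ.D (Nat.zero_le _) le_rfl le_rfl y y (by simp)
    have h2 := Γ.hp 0 Γ.D Γ.D (Nat.zero_le _) le_rfl le_rfl x x (by simp)
    have : 0 < Nat.card {w : X // Γ.G.dist y w = Γ.D ∧ Γ.G.dist y w = Γ.D} :=
      Nat.card_pos_iff.2 ⟨⟨⟨z, hyz, hyz⟩⟩, inferInstance⟩
    rw [h1, ← h2] at this
    obtain ⟨⟨⟨w, hw, -⟩⟩, -⟩ := Nat.card_pos_iff.1 this
    exact ⟨w, by rwa [SimpleGraph.dist_comm]⟩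
  have key : ∀ m n, n + m = Γ.D → ∃ z, Γ.G.dist z x = n := by
    intro m
    induction m with
    | zero => intro n h; obtain rfl : n = Γ.D := by omega
              exact hD
    | succ m ih =>
      intro n h
      obtain ⟨z, hz⟩ := ih (n + 1) (by omega)
      obtain ⟨w, -, hw⟩ := Γ.exists_dist_pred hz
      exact ⟨w, hw⟩
  obtain ⟨z, hz⟩ := key (Γ.D - n) n (by omega)
  exact ⟨z, by rwa [SimpleGraph.dist_comm]⟩

theorem p_comm {h i j : ℕ} (hh : h ≤ Γ.D) (hi : i ≤ Γ.D) (hj : j ≤ Γ.D) :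
    Γ.p h i j = Γ.p h j i := by
  obtain ⟨x, -⟩ := Γ.hdiam
  obtain ⟨z, hz⟩ := Γ.exists_dist_eq x hh
  rw [← Γ.hp h i j hh hi hj x z hz,
    ← Γ.hp h j i hh hj hi z x (by rwa [SimpleGraph.dist_comm])]
  exact Nat.card_congr (Equiv.subtypeEquivRight fun w => and_comm)

theorem p_succ_pos {n : ℕ} (hn : n + 1 ≤ Γ.D) : 0 < Γ.p (n + 1) 1 n := by
  obtain ⟨x, -⟩ := Γ.hdiam
  obtain ⟨z, hz⟩ := Γ.exists_dist_eq x hn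
  obtain ⟨w, hw1, hw2⟩ := Γ.exists_dist_pred hz
  rw [← Γ.hp (n + 1) 1 n hn (by omega) (by omega) x z hz]
  exact Nat.card_pos_iff.2 ⟨⟨⟨w, hw1, by rwa [SimpleGraph.dist_comm]⟩⟩, inferInstance⟩

theorem A_zero : Γ.A 0 = 1 := by
  ext y z
  rw [A_apply, Matrix.one_apply]
  simp [Γ.hconn.dist_eq_zero_iff]

theorem A_one_mul_A_one :
    Γ.A 1 * Γ.A 1 = (Γ.p 2 1 1 : ℂ) • Γ.A 2 + (Γ.p 1 1 1 : ℂ) • Γ.A 1 +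
      (Γ.kval : ℂ) • (1 : Matrix X X ℂ) := by
  have hD := Γ.hD
  rw [← A_zero]
  ext y z
  simp only [Matrix.add_apply, Matrix.smul_apply, A_apply, smul_eq_mul]
  rw [Γ.A_mul_A_apply (by omega) (by omega) rfl]
  by_cases h : Γ.G.dist y z ≤ 2
  · generalize Γ.G.dist y z = d at h ⊢
    interval_cases d <;> simp [kval]
  · have h0 : Γ.p (Γ.G.dist y z) 1 1 = 0 := by
      rw [← Γ.hp _ 1 1 (Γ.hdiam_le y z) (by omega) (by omega) y z rfl, Nat.card_eq_zero]
      left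
      refine ⟨fun ⟨w, h1, h2⟩ => h ?_⟩
      have := Γ.hconn.dist_triangle (u := y) (v := w) (w := z)
      rw [SimpleGraph.dist_comm] at h2
      omega
    rw [h0, if_neg (by omega), if_neg (by omega), if_neg (by omega)]
    simp

theorem A_one_mulVec_one : Γ.A 1 *ᵥ (fun _ => 1) = (Γ.kval : ℂ) • fun _ => (1 : ℂ) := by
  have hD := Γ.hD
  ext y
  have := Γ.A_mul_A_apply (i := 1) (j := 1) (by omega) (by omega) (y := y) (z := y) (h := 0)
    (by simp)
  simp only [Matrix.mulVec, dotProduct, Pi.smul_apply, smul_eq_mul, mul_one, kval]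
  rw [← this, Matrix.mul_apply]
  refine Finset.sum_congr rfl fun w _ => ?_
  rw [A_apply, A_apply, SimpleGraph.dist_comm (u := w)]
  split_ifs <;> simp

open ComplexOrder in
/-- A monic polynomial of degree `n` in `A` vanishes beyond distance `n` and is positive at
distance `n`. -/
theorem aeval_prod_apply {ι : Type*} [DecidableEq ι] (θ : ι → ℂ) (s : Finset ι) :
    ∀ y z : X,
      (s.card < Γ.G.dist y z →
        (Polynomial.aeval (Γ.A 1) (∏ i ∈ s, (Polynomial.X - Polynomial.C (θ i)))) y z = 0) ∧
      (Γ.G.dist y z = s.card →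
        0 < (Polynomial.aeval (Γ.A 1) (∏ i ∈ s, (Polynomial.X - Polynomial.C (θ i)))) y z) := by
  induction s using Finset.induction_on with
  | empty =>
    intro y z
    simp only [Finset.card_empty, Finset.prod_empty, map_one]
    refine ⟨fun h => Matrix.one_apply_ne ?_, fun h => ?_⟩
    · rintro rfl
      simp at h
    · rw [Γ.hconn.dist_eq_zero_iff] at h
      rw [h, Matrix.one_apply_eq]
      exact zero_lt_one
  | @insert a s ha ih =>
    intro y z
    rw [Finset.card_insert_of_notMem ha, Finset.prod_insert ha, map_mul]
    generalize Polynomial.aeval (Γ.A 1) (∏ i ∈ s, (Polynomial.X - Polynomial.C (θ i))) = P at ih ⊢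
    have hexp : (Polynomial.aeval (Γ.A 1) (Polynomial.X - Polynomial.C (θ a)) * P) y z =
        ∑ w, Γ.A 1 y w * P w z - θ a * P y z := by
      rw [map_sub, Polynomial.aeval_X, Polynomial.aeval_C, Algebra.algebraMap_eq_smul_one, sub_mul,
        smul_mul_assoc, one_mul, Matrix.sub_apply, Matrix.mul_apply, Matrix.smul_apply, smul_eq_mul]
    rw [hexp]
    have htri : ∀ w, Γ.G.dist y w = 1 → Γ.G.dist y z ≤ 1 + Γ.G.dist w z := fun w hw => by
      have := Γ.hconn.dist_triangle (u := y) (v := w) (w := z)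
      omega
    refine ⟨fun h => ?_, fun h => ?_⟩
    · rw [(ih y z).1 (by omega), mul_zero, sub_zero]
      refine Finset.sum_eq_zero fun w _ => ?_
      rw [A_apply]
      split_ifs with hw
      · rw [(ih w z).1 (by have := htri w hw; omega), mul_zero]
      · rw [zero_mul]
    · rw [(ih y z).1 (by omega), mul_zero, sub_zero]
      obtain ⟨w, hw1, hw2⟩ := Γ.exists_dist_pred h
      refine Finset.sum_pos' (fun w _ => ?_) ⟨w, Finset.mem_univ _, ?_⟩
      · rw [A_apply]
        split_ifs with hw
        · rw [one_mul]
          rcases (Nat.lt_or_ge s.card (Γ.G.dist w z)) with hlt | hge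
          · rw [(ih w z).1 hlt]
          · exact ((ih w z).2 (by have := htri w hw; omega)).le
        · rw [zero_mul]
      · rw [A_apply, if_pos hw1, one_mul]
        exact (ih w z).2 hw2

end DRG

namespace IdemSys

variable {X : Type} [Fintype X] [DecidableEq X] {Γ : DRG X} (I : IdemSys Γ)

open ComplexOrder in
theorem E_ne_zero (t : Fin (Γ.D + 1)) : I.E t ≠ 0 := by
  intro h0
  obtain ⟨y, z, hyz⟩ := Γ.hdiam
  set s := Finset.univ.erase t with hs
  have hcard : s.card = Γ.D := by simp [hs]
  set P := ∏ i ∈ s, (Polynomial.X - Polynomial.C (I.θ i : ℂ)) with hP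
  have hpos := (Γ.aeval_prod_apply (fun i => (I.θ i : ℂ)) s y z).2 (by rw [hcard, hyz])
  rw [← hP] at hpos
  have hzero : Polynomial.aeval (Γ.A 1) P = 0 := by
    rw [← mul_one (Polynomial.aeval (Γ.A 1) P), ← I.hEsum, Finset.mul_sum]
    refine Finset.sum_eq_zero fun j _ => ?_
    rcases eq_or_ne j t with rfl | hj
    · rw [h0, mul_zero]
    · have hjs : j ∈ s := by simp [hs, hj]
      rw [hP, ← Finset.prod_erase_mul _ _ hjs, map_mul, mul_assoc, map_sub, Polynomial.aeval_X,
        Polynomial.aeval_C, Algebra.algebraMap_eq_smul_one, sub_mul, I.hEig, smul_mul_assoc,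
        one_mul, sub_self, mul_zero]
  rw [hzero] at hpos
  exact lt_irrefl _ hpos

theorem exists_E_apply (t : Fin (Γ.D + 1)) : ∃ e : ℕ → ℂ, ∀ y z, I.E t y z = e (Γ.G.dist y z) := by
  have ht := I.hEbasis t
  generalize I.E t = M at ht ⊢
  induction ht using Submodule.span_induction with
  | mem M hM =>
    obtain ⟨n, rfl⟩ := hM
    exact ⟨fun h => if h = n then 1 else 0, fun y z => rfl⟩
  | zero => exact ⟨0, fun y z => rfl⟩
  | add M N _ _ hM hN =>
    obtain ⟨e, he⟩ := hM
    obtain ⟨f, hf⟩ := hN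
    exact ⟨e + f, fun y z => by simp [he, hf]⟩
  | smul c M _ hM =>
    obtain ⟨e, he⟩ := hM
    exact ⟨c • e, fun y z => by simp [he]⟩

open ComplexOrder in
theorem E_row_eq (t : Fin (Γ.D + 1)) {e : ℕ → ℂ} (he : ∀ y z, I.E t y z = e (Γ.G.dist y z))
    {y z : X} (h : e (Γ.G.dist y z) = e 0) : I.E t y = I.E t z := by
  have hsq : ∀ y z, ∑ w, I.E t y w * I.E t z w = I.E t y z := fun y z => by
    have h1 := congrFun (congrFun (I.hEmul t t) y) z
    rw [if_pos rfl, Matrix.mul_apply] at h1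
    rw [← h1]
    refine Finset.sum_congr rfl fun w _ => ?_
    rw [← Matrix.transpose_apply (I.E t) w z, I.hEsymm]
  have hstar : star (I.E t y - I.E t z) = I.E t y - I.E t z := by
    ext w
    have h1 := congrFun (congrFun (I.hEreal t) y) w
    have h2 := congrFun (congrFun (I.hEreal t) z) w
    simp only [Matrix.map_apply] at h1 h2
    simp [h1, h2]
  refine sub_eq_zero.1 (dotProduct_star_self_eq_zero.1 ?_)
  rw [hstar]
  simp only [dotProduct, Pi.sub_apply]
  have : ∀ w, (I.E t y w - I.E t z w) * (I.E t y w - I.E t z w) =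
      I.E t y w * I.E t y w - I.E t y w * I.E t z w - (I.E t z w * I.E t y w)
        + I.E t z w * I.E t z w := fun w => by ring
  simp only [this, Finset.sum_add_distrib, Finset.sum_sub_distrib, hsq]
  rw [he, he, he, he, SimpleGraph.dist_comm (u := z) (v := y), h]
  simp

/-- In a primitive graph the cosines of a nontrivial idempotent differ from the first one. -/
theorem cosine_ne (hprim : Γ.Primitive) (t : Fin (Γ.D + 1)) (ht : 1 ≤ (t : ℕ)) {e : ℕ → ℂ}
    (he : ∀ y z, I.E t y z = e (Γ.G.dist y z)) {i : ℕ} (hi : 1 ≤ i) (hiD : i ≤ Γ.D) :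
    e i ≠ e 0 := by
  intro h
  have hrow : ∀ y z, I.E t y = I.E t z := by
    intro y z
    obtain ⟨q⟩ := (hprim i hi hiD).preconnected y z
    induction q with
    | nil => rfl
    | cons hadj _ ih =>
      refine Eq.trans ?_ ih
      rw [SimpleGraph.fromRel_adj] at hadj
      rcases hadj.2 with h1 | h1
      · exact I.E_row_eq t he (by rw [h1, h])
      · exact (I.E_row_eq t he (by rw [h1, h])).symm
  have ht0 : t ≠ 0 := by
    rintro rfl
    simp at ht
  apply I.E_ne_zero t
  have hmul := I.hEmul 0 t
  rw [if_neg ht0.symm, I.hE0] at hmul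
  ext y z
  have h1 := congrFun (congrFun hmul y) z
  have hX : (Fintype.card X : ℂ) ≠ 0 := by
    have : Nonempty X := ⟨y⟩
    exact Nat.cast_ne_zero.2 Fintype.card_ne_zero
  have hs : ∑ w, I.E t w z = Fintype.card X * I.E t y z := by
    simp [fun w => congrFun (hrow w y) z]
  rw [smul_mul_assoc, Matrix.smul_apply, Matrix.mul_apply] at h1
  simp only [Matrix.of_apply, one_mul, hs, smul_eq_mul] at h1
  rwa [inv_mul_cancel_left₀ hX] at h1

end IdemSys

theorem sub_smul_one_mul_add_one_comm {X : Type} [Fintype X] [DecidableEq X] (A : Matrix X X ℂ)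
    (k : ℂ) : (A - k • 1) * (A + 1) = (A + 1) * (A - k • 1) := by
  simp only [sub_mul, mul_add, add_mul, mul_sub, mul_one, one_mul, smul_mul_assoc,
    mul_smul_comm, smul_add]
  abel

/-- If `A[A,B]A = -k[A,B]` then the kernel of `(A - k)(A + 1)` is invariant under `B`. -/
theorem mulVec_mulVec_eq_zero_of_commutator {X : Type} [Fintype X] [DecidableEq X]
    {A B : Matrix X X ℂ} {k : ℂ} (hk0 : k ≠ 0) (hk : k + 1 ≠ 0)
    (hC : A * (A * B - B * A) * A = -k • (A * B - B * A)) {v : X → ℂ}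
    (hv : ((A - k • 1) * (A + 1)) *ᵥ v = 0) : ((A - k • 1) * (A + 1)) *ᵥ (B *ᵥ v) = 0 := by
  have hcomm : (A - k • 1) * (A + 1) = (A + 1) * (A - k • 1) := sub_smul_one_mul_add_one_comm A k
  have hCA : ∀ u, A *ᵥ ((A * B - B * A) *ᵥ (A *ᵥ u)) = -k • ((A * B - B * A) *ᵥ u) := fun u => by
    rw [Matrix.mulVec_mulVec, Matrix.mulVec_mulVec, hC, Matrix.smul_mulVec]
  have hk1 : ∀ u, (A - k • 1) *ᵥ u = 0 → ((A - k • 1) * (A + 1)) *ᵥ (B *ᵥ u) = 0 := by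
    intro u hu
    have hu' : A *ᵥ u = k • u := by
      rwa [Matrix.sub_mulVec, Matrix.smul_mulVec, Matrix.one_mulVec, sub_eq_zero] at hu
    have h1 := hCA u
    have h2 : (A * B - B * A) *ᵥ u = (A - k • 1) *ᵥ (B *ᵥ u) := by
      simp only [Matrix.sub_mulVec, ← Matrix.mulVec_mulVec, hu', Matrix.smul_mulVec,
        Matrix.one_mulVec, Matrix.mulVec_smul]
    rw [hu', Matrix.mulVec_smul, Matrix.mulVec_smul, neg_smul, ← smul_neg] at h1
    have h3 := smul_right_injective _ hk0 h1
    rw [h2] at h3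
    rw [hcomm, ← Matrix.mulVec_mulVec, Matrix.add_mulVec, Matrix.one_mulVec, h3, neg_add_cancel]
  have hm1 : ∀ u, (A + 1) *ᵥ u = 0 → ((A - k • 1) * (A + 1)) *ᵥ (B *ᵥ u) = 0 := by
    intro u hu
    have hu' : A *ᵥ u = -u := by
      rwa [Matrix.add_mulVec, Matrix.one_mulVec, add_eq_zero_iff_eq_neg] at hu
    have h1 := hCA u
    have h2 : (A * B - B * A) *ᵥ u = (A + 1) *ᵥ (B *ᵥ u) := by
      simp only [Matrix.sub_mulVec, ← Matrix.mulVec_mulVec, hu', Matrix.add_mulVec,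
        Matrix.one_mulVec, Matrix.mulVec_neg, sub_neg_eq_add]
    rw [hu', Matrix.mulVec_neg, Matrix.mulVec_neg, neg_smul, neg_inj, h2] at h1
    rw [← Matrix.mulVec_mulVec, Matrix.sub_mulVec, h1, Matrix.smul_mulVec, Matrix.one_mulVec,
      sub_self]
  have hdec : (k + 1) • v = (A + 1) *ᵥ v - (A - k • 1) *ᵥ v := by
    simp only [Matrix.sub_mulVec, Matrix.add_mulVec, Matrix.smul_mulVec, Matrix.one_mulVec,
      add_smul, one_smul]
    abel
  have h1 := hk1 ((A + 1) *ᵥ v) (by rw [Matrix.mulVec_mulVec, hv])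
  have h2 := hm1 ((A - k • 1) *ᵥ v) (by rw [Matrix.mulVec_mulVec, ← hcomm, hv])
  have h3 : (k + 1) • (((A - k • 1) * (A + 1)) *ᵥ (B *ᵥ v)) = 0 := by
    rw [← Matrix.mulVec_smul, ← Matrix.mulVec_smul, hdec, Matrix.mulVec_sub, Matrix.mulVec_sub,
      h1, h2, sub_zero]
  exact (smul_eq_zero.1 h3).resolve_left hk

namespace DRG

variable {X : Type} [Fintype X] [DecidableEq X] (Γ : DRG X)

theorem A_mul_diagonal_mul_A_apply (g : ℕ → ℂ) (x z : X) (i j : ℕ) :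
    (Γ.A i * Matrix.diagonal (fun y => g (Γ.G.dist x y)) * Γ.A j) x z =
      g i * (Γ.A i * Γ.A j) x z := by
  rw [Matrix.mul_apply, Matrix.mul_apply, Finset.mul_sum]
  refine Finset.sum_congr rfl fun w _ => ?_
  rw [Matrix.mul_diagonal, A_apply Γ i]
  split_ifs with h
  · rw [h]
    ring
  · ring

/-- No diagonal matrix whose entry at `x` differs from all its other entries satisfies
`A B A₂ = A₂ B A`. -/
theorem A_one_mul_diagonal_mul_A_two_ne {f : X → ℂ} {x : X} (hf : ∀ y, y ≠ x → f x ≠ f y) :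
    Γ.A 1 * Matrix.diagonal f * Γ.A 2 ≠ Γ.A 2 * Matrix.diagonal f * Γ.A 1 := by
  intro h
  have hD := Γ.hD
  set B := Matrix.diagonal f with hB
  set k : ℂ := (Γ.kval : ℂ) with hk
  have hk0 : k ≠ 0 := by
    have h1 : 0 < Γ.kval := by
      obtain ⟨z, hz⟩ := Γ.exists_dist_eq x (n := 1) (by omega)
      rw [kval, ← Γ.hp 0 1 1 (by omega) (by omega) (by omega) x x (by simp)]
      exact Nat.card_pos_iff.2 ⟨⟨⟨z, hz, hz⟩⟩, inferInstance⟩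
    exact Nat.cast_ne_zero.2 h1.ne'
  have hk1 : k + 1 ≠ 0 := Nat.cast_add_one_ne_zero _
  have hA2 : (Γ.p 2 1 1 : ℂ) • Γ.A 2 =
      Γ.A 1 * Γ.A 1 - (Γ.p 1 1 1 : ℂ) • Γ.A 1 - k • (1 : Matrix X X ℂ) := by
    rw [A_one_mul_A_one]
    abel
  have hC : Γ.A 1 * (Γ.A 1 * B - B * Γ.A 1) * Γ.A 1 = -k • (Γ.A 1 * B - B * Γ.A 1) := by
    have h1 := congrArg (fun M => (Γ.p 2 1 1 : ℂ) • M) h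
    rw [← mul_smul_comm, ← smul_mul_assoc, ← smul_mul_assoc, hA2] at h1
    rw [← sub_eq_zero] at h1 ⊢
    rw [← neg_eq_zero, ← h1]
    simp only [sub_mul, mul_sub, mul_one, one_mul, smul_mul_assoc, mul_smul_comm, neg_smul,
      smul_sub, mul_assoc]
    abel
  have hmem : ∀ s : Finset X,
      ((Γ.A 1 - k • 1) * (Γ.A 1 + 1)) *ᵥ (fun z => ∏ y ∈ s, (f z - f y)) = 0 := by
    intro s
    induction s using Finset.induction_on with
    | empty =>
      simp only [Finset.prod_empty]
      rw [sub_smul_one_mul_add_one_comm, ← Matrix.mulVec_mulVec, Matrix.sub_mulVec, A_one_mulVec_one, Matrix.smul_mulVec,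
        Matrix.one_mulVec, sub_self, Matrix.mulVec_zero]
    | @insert a s ha ih =>
      have h1 : (fun z => ∏ y ∈ insert a s, (f z - f y)) =
          B *ᵥ (fun z => ∏ y ∈ s, (f z - f y)) - f a • fun z => ∏ y ∈ s, (f z - f y) := by
        ext z
        rw [Finset.prod_insert ha, hB]
        simp only [Pi.sub_apply, Matrix.mulVec_diagonal, Pi.smul_apply, smul_eq_mul]
        ring
      rw [h1, Matrix.mulVec_sub, Matrix.mulVec_smul, ih, smul_zero, sub_zero]
      exact mulVec_mulVec_eq_zero_of_commutator hk0 hk1 hC ih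
  have hv : (fun z => ∏ y ∈ Finset.univ.erase x, (f z - f y)) =
      Pi.single x (∏ y ∈ Finset.univ.erase x, (f x - f y)) := by
    ext z
    rcases eq_or_ne z x with rfl | hz
    · rw [Pi.single_eq_same]
    · rw [Pi.single_eq_of_ne hz]
      exact Finset.prod_eq_zero (Finset.mem_erase.2 ⟨hz, Finset.mem_univ z⟩) (sub_self _)
  obtain ⟨z, hz⟩ := Γ.exists_dist_eq x (n := 2) (by omega)
  rw [SimpleGraph.dist_comm] at hz
  have hzx : z ≠ x := by
    rintro rfl
    simp at hz
  have h1 := congrFun (hmem (Finset.univ.erase x)) z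
  rw [hv, Matrix.mulVec_single] at h1
  have hprod : ∏ y ∈ Finset.univ.erase x, (f x - f y) ≠ 0 :=
    Finset.prod_ne_zero_iff.2 fun y hy => sub_ne_zero.2 (hf y (Finset.ne_of_mem_erase hy))
  have hentry : ((Γ.A 1 - k • 1) * (Γ.A 1 + 1)) z x = (Γ.p 2 1 1 : ℂ) := by
    rw [← Γ.A_mul_A_apply (i := 1) (j := 1) (by omega) (by omega) hz]
    simp only [sub_mul, mul_add, mul_one, smul_mul_assoc, one_mul, Matrix.sub_apply,
      Matrix.add_apply, Matrix.smul_apply, Matrix.one_apply_ne hzx, A_apply Γ 1 z x, hz]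
    simp
  simp [hentry, hprod, (Γ.p_succ_pos (n := 1) (by omega)).ne'] at h1

end DRG

/-- if `Γ` is primitive then for every `1 ≤ t ≤ D` the three matrices
`AA_t*A_2 − A_2A_t*A, A_t*A_2 − A_2A_t*, A_t*A − AA_t*` are linearly independent over `ℂ`. -/
theorem stmt_16 {X : Type} [Fintype X] [DecidableEq X] (Γ : DRG X) (hprim : Γ.Primitive)
    (I : IdemSys Γ) (x : X) :
    ∀ t : Fin (Γ.D + 1), 1 ≤ (t : ℕ) →
      LinearIndependent ℂ
        ![Γ.A 1 * I.Astar x t * Γ.A 2 - Γ.A 2 * I.Astar x t * Γ.A 1,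
          I.Astar x t * Γ.A 2 - Γ.A 2 * I.Astar x t,
          I.Astar x t * Γ.A 1 - Γ.A 1 * I.Astar x t] := by
  intro t ht
  have hD := Γ.hD
  obtain ⟨e, he⟩ := I.exists_E_apply t
  have hX : (Fintype.card X : ℂ) ≠ 0 := by
    have : Nonempty X := ⟨x⟩
    exact Nat.cast_ne_zero.2 Fintype.card_ne_zero
  set g : ℕ → ℂ := fun i => (Fintype.card X : ℂ) * e i with hg
  have hB : I.Astar x t = Matrix.diagonal fun y => g (Γ.G.dist x y) := by
    simp only [IdemSys.Astar, he, hg]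
  have hne : ∀ i, 1 ≤ i → i ≤ Γ.D → g 0 - g i ≠ 0 := fun i h1 h2 => by
    rw [hg, sub_ne_zero]
    exact fun h => I.cosine_ne hprim t ht he h1 h2 (mul_left_cancel₀ hX h).symm
  rw [hB, Fintype.linearIndependent_iff]
  intro c hc
  simp only [Fin.sum_univ_three, Matrix.cons_val_zero, Matrix.cons_val_one, Matrix.cons_val] at hc
  have hentry : ∀ h, h ≤ Γ.D →
      c 0 * ((g 1 - g 2) * Γ.p h 1 2) + c 1 * ((g 0 - g h) * if h = 2 then 1 else 0) +
        c 2 * ((g 0 - g h) * if h = 1 then 1 else 0) = 0 := by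
    intro h hh
    obtain ⟨z, hz⟩ := Γ.exists_dist_eq x hh
    have h1 := congrFun (congrFun hc x) z
    simp only [Matrix.add_apply, Matrix.sub_apply, Matrix.smul_apply, smul_eq_mul,
      Γ.A_mul_diagonal_mul_A_apply, Matrix.diagonal_mul, Matrix.mul_diagonal,
      Γ.A_mul_A_apply (show 1 ≤ Γ.D by omega) (show 2 ≤ Γ.D by omega) hz,
      Γ.A_mul_A_apply (show 2 ≤ Γ.D by omega) (show 1 ≤ Γ.D by omega) hz,
      Γ.p_comm hh (show 2 ≤ Γ.D by omega) (show 1 ≤ Γ.D by omega),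
      DRG.A_apply, hz, SimpleGraph.dist_self, Matrix.zero_apply] at h1
    refine Eq.trans ?_ h1
    ring
  have hα : c 0 * (g 1 - g 2) = 0 := by
    have h3 := hentry 3 hD
    have hp : (Γ.p 3 1 2 : ℂ) ≠ 0 := Nat.cast_ne_zero.2 (Γ.p_succ_pos (n := 2) hD).ne'
    simpa [hp] using h3
  have h1 : c 1 = 0 := by
    have h2 := hentry 2 (by omega)
    rw [← mul_assoc, hα] at h2
    simpa [hne 2 (by omega) (by omega)] using h2
  have h2 : c 2 = 0 := by
    have h2 := hentry 1 (by omega)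
    rw [← mul_assoc, hα] at h2
    simpa [hne 1 (by omega) (by omega)] using h2
  have h0 : c 0 = 0 := by
    rw [h1, h2, zero_smul, zero_smul, add_zero, add_zero, smul_eq_zero] at hc
    refine hc.resolve_right fun h => ?_
    refine Γ.A_one_mul_diagonal_mul_A_two_ne (x := x) (fun y hy => ?_) (sub_eq_zero.1 h)
    rw [SimpleGraph.dist_self]
    exact sub_ne_zero.1 (hne _ (Γ.hconn.pos_dist_of_ne hy.symm) (Γ.hdiam_le x y))
  intro i
  fin_cases i
  exacts [h0, h1, h2]
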